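/- arXiv:0905.3960 — 2 statements merged into one kernel-verified Lean document; each statement's English description precedes it below -/
import Mathlib

section
/- Let G be a countable group acting by automorphisms on a countable group W, and let ψ be a W-invariant, G-equivariant 𝒜-gauge on W, where 𝒜 is the set of finite subsets of G. Assume there exists a conditionally negative definite kernel u on W which is G-invariant (u(g·v, g·w) = u(v,w)), W-uniform (for all w₁,w₂ ∈ W, sup_{v∈W} u(vw₁, vw₂) < ∞), and such that for every finite subset F ⊆ G and every R > 0 the set {v⁻¹w : v,w ∈ W, ψ(v⁻¹w) ⊆ F and u(v,w) ≤ R} is finite. Then W ⋊ G admits a coarse embedding into a real Hilbert space if and only if G does. -/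
open MeasureTheory Function Set
open scoped ENNReal
/-- A conditionally negative definite kernel: symmetric, vanishing on the diagonal,
with `∑ᵢⱼ cᵢcⱼ κ(xᵢ,xⱼ) ≤ 0` whenever `∑ᵢ cᵢ = 0`. -/
def IsCNDKernel {X : Type*} (κ : X → X → ℝ) : Prop :=
  (∀ x y, κ x y = κ y x) ∧ (∀ x, κ x x = 0) ∧
    ∀ (n : ℕ) (x : Fin n → X) (c : Fin n → ℝ), (∑ i, c i) = 0 →
      ∑ i, ∑ j, c i * c j * κ (x i) (x j) ≤ 0

/-- A conditionally negative definite function on a group. -/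
def IsCNDFunction {G : Type*} [Group G] (ψ : G → ℝ) : Prop :=
  IsCNDKernel fun g h => ψ (g⁻¹ * h)

/-- A proper function on a group: sublevel sets are finite. -/
def IsProperFunction {G : Type*} [Group G] (ψ : G → ℝ) : Prop :=
  ∀ R : ℝ, {g : G | ψ g ≤ R}.Finite
/-- The group `Γ` admits a coarse embedding into a real Hilbert space. -/
def AdmitsCoarseEmb (Γ : Type*) [Group Γ] : Prop :=
  ∃ (E : Type) (_ : NormedAddCommGroup E) (_ : InnerProductSpace ℝ E) (_ : CompleteSpace E)
    (f : Γ → E),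
      (∀ F : Set Γ, F.Finite → ∃ M : ℝ, ∀ x y : Γ, x⁻¹ * y ∈ F → ‖f x - f y‖ ≤ M) ∧
      ∀ R : ℝ, {d : Γ | ∃ x y : Γ, x⁻¹ * y = d ∧ ‖f x - f y‖ ≤ R}.Finite

section CNDKernel

variable {X Y : Type*}

theorem IsCNDKernel.comp {κ : X → X → ℝ} (hκ : IsCNDKernel κ) (g : Y → X) :
    IsCNDKernel fun a b => κ (g a) (g b) :=
  ⟨fun _ _ => hκ.1 _ _, fun _ => hκ.2.1 _, fun n x c hc => hκ.2.2 n (fun i => g (x i)) c hc⟩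

theorem IsCNDKernel.add {κ κ' : X → X → ℝ} (h : IsCNDKernel κ) (h' : IsCNDKernel κ') :
    IsCNDKernel fun a b => κ a b + κ' a b := by
  refine ⟨fun a b => by simp only [h.1 a b, h'.1 a b], fun a => by simp [h.2.1, h'.2.1],
    fun n x c hc => ?_⟩
  simp only [mul_add, Finset.sum_add_distrib]
  exact add_nonpos (h.2.2 n x c hc) (h'.2.2 n x c hc)

theorem IsCNDKernel.const_mul {κ : X → X → ℝ} (h : IsCNDKernel κ) {r : ℝ} (hr : 0 ≤ r) :
    IsCNDKernel fun a b => r * κ a b := by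
  refine ⟨fun a b => by simp only [h.1 a b], fun a => by simp [h.2.1], fun n x c hc => ?_⟩
  have : ∑ i, ∑ j, c i * c j * (r * κ (x i) (x j))
      = r * ∑ i, ∑ j, c i * c j * κ (x i) (x j) := by
    simp only [Finset.mul_sum]
    exact Finset.sum_congr rfl fun i _ => Finset.sum_congr rfl fun j _ => by ring
  rw [this]
  exact mul_nonpos_of_nonneg_of_nonpos hr (h.2.2 n x c hc)

theorem IsCNDKernel.finsetSum {ι : Type*} (s : Finset ι) {κ : ι → X → X → ℝ}
    (h : ∀ i ∈ s, IsCNDKernel (κ i)) : IsCNDKernel fun a b => ∑ i ∈ s, κ i a b := by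
  classical
  induction s using Finset.induction with
  | empty => exact ⟨by simp, by simp, by simp⟩
  | insert i s hi ih =>
    simp only [Finset.sum_insert hi]
    exact (h i (by simp)).add (ih fun j hj => h j (by simp [hj]))

theorem IsCNDKernel.of_tendsto {ι : Type*} {l : Filter ι} [l.NeBot] {κ : ι → X → X → ℝ}
    {κ' : X → X → ℝ} (h : ∀ i, IsCNDKernel (κ i))
    (hl : ∀ a b, Filter.Tendsto (fun i => κ i a b) l (nhds (κ' a b))) : IsCNDKernel κ' := by
  refine ⟨fun a b => ?_, fun a => ?_, fun n x c hc => ?_⟩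
  · refine tendsto_nhds_unique (hl a b) ?_
    simpa only [(h _).1 a b] using hl b a
  · refine tendsto_nhds_unique (hl a a) ?_
    simp only [(h _).2.1 a]
    exact tendsto_const_nhds
  · refine le_of_tendsto (x := l) (f := fun k => ∑ i, ∑ j, c i * c j * κ k (x i) (x j)) ?_
      (Filter.Eventually.of_forall fun k => (h k).2.2 n x c hc)
    exact tendsto_finsetSum _ fun i _ => tendsto_finsetSum _ fun j _ =>
      (hl (x i) (x j)).const_mul _

theorem IsCNDKernel.nonneg {κ : X → X → ℝ} (h : IsCNDKernel κ) (a b : X) : 0 ≤ κ a b := by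
  have := h.2.2 2 ![a, b] ![1, -1] (by simp)
  simp [Fin.sum_univ_two, h.2.1, h.1 b a] at this
  linarith

/-- The kernel based at `o` associated with a conditionally negative definite kernel is positive
semidefinite. -/
theorem IsCNDKernel.sum_gromovProduct_nonneg {κ : X → X → ℝ} (h : IsCNDKernel κ) (o : X) {n : ℕ}
    (x : Fin n → X) (c : Fin n → ℝ) :
    0 ≤ ∑ i, ∑ j, c i * c j * ((κ (x i) o + κ (x j) o - κ (x i) (x j)) / 2) := by
  have key := h.2.2 (n + 1) (Fin.cons o x) (Fin.cons (-∑ i, c i) c) (by simp [Fin.sum_univ_succ])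
  simp only [Fin.sum_univ_succ, Fin.cons_zero, Fin.cons_succ, h.2.1, mul_zero, zero_add,
    Finset.sum_add_distrib, h.1 o] at key
  have h1 : ∑ i, -(∑ i, c i) * c i * κ (x i) o = -((∑ i, c i) * ∑ i, c i * κ (x i) o) := by
    rw [← neg_mul, Finset.mul_sum]
    exact Finset.sum_congr rfl fun i _ => by ring
  have h2 : ∑ i, c i * -(∑ i, c i) * κ (x i) o = -((∑ i, c i) * ∑ i, c i * κ (x i) o) := by
    rw [← neg_mul, Finset.mul_sum]
    exact Finset.sum_congr rfl fun i _ => by ring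
  have h3 : ∑ i, ∑ j, c i * c j * ((κ (x i) o + κ (x j) o - κ (x i) (x j)) / 2)
      = ((∑ i, c i * κ (x i) o) * (∑ j, c j) + (∑ i, c i) * (∑ j, c j * κ (x j) o)
        - ∑ i, ∑ j, c i * c j * κ (x i) (x j)) / 2 := by
    rw [Finset.sum_mul_sum, Finset.sum_mul_sum, ← Finset.sum_add_distrib,
      ← Finset.sum_sub_distrib, Finset.sum_div]
    refine Finset.sum_congr rfl fun i _ => ?_
    rw [← Finset.sum_add_distrib, ← Finset.sum_sub_distrib, Finset.sum_div]
    exact Finset.sum_congr rfl fun j _ => by ring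
  rw [h3]
  rw [h1, h2] at key
  linarith

theorem IsCNDKernel.finsetSum_gromovProduct_nonneg {κ : X → X → ℝ} (h : IsCNDKernel κ) (o : X)
    (s : Finset X) (c : X → ℝ) :
    0 ≤ ∑ i ∈ s, ∑ j ∈ s, c i * c j * ((κ i o + κ j o - κ i j) / 2) := by
  have hsum : ∀ F : X → ℝ, ∑ i, F (s.equivFin.symm i) = ∑ i ∈ s, F i := fun F => by
    rw [Equiv.sum_comp s.equivFin.symm fun i : s => F i, Finset.univ_eq_attach, Finset.sum_attach]
  have key := h.sum_gromovProduct_nonneg o (fun i => (s.equivFin.symm i : X))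
    (fun i => c (s.equivFin.symm i))
  refine key.trans_eq ((Finset.sum_congr rfl fun i _ => hsum fun j =>
    c (s.equivFin.symm i) * c j * ((κ (s.equivFin.symm i) o + κ j o
      - κ (s.equivFin.symm i) j) / 2)).trans ?_)
  exact hsum fun i => ∑ j ∈ s, c i * c j * ((κ i o + κ j o - κ i j) / 2)

/-- A conditionally negative definite kernel is a squared Hilbert distance. -/
theorem IsCNDKernel.exists_norm_sub_sq_eq {X : Type} {κ : X → X → ℝ} (h : IsCNDKernel κ) :
    ∃ (E : Type) (_ : NormedAddCommGroup E) (_ : InnerProductSpace ℝ E) (_ : CompleteSpace E)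
      (f : X → E), ∀ x y, ‖f x - f y‖ ^ 2 = κ x y := by
  rcases isEmpty_or_nonempty X with hX | ⟨⟨o⟩⟩
  · exact ⟨ℝ, inferInstance, inferInstance, inferInstance, fun _ => 0, fun x => hX.elim x⟩
  let K : Matrix X X (ℝ →L[ℝ] ℝ) := Matrix.of fun x y =>
    ((κ x o + κ y o - κ x y) / 2) • ContinuousLinearMap.id ℝ ℝ
  have hK : K.PosSemidef := by
    have tfae := (RKHS.posSemidef_tfae (K := K)).out 0 2
    refine tfae.2 ⟨?_, fun v => ?_⟩
    · ext x y
      rw [Matrix.conjTranspose_apply]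
      simp [K, h.1 y x, add_comm, ContinuousLinearMap.star_eq_adjoint,
        ContinuousLinearMap.adjoint_id]
    · have key := h.finsetSum_gromovProduct_nonneg o v.support v
      refine key.trans_eq ?_
      simp only [Finsupp.sum, RCLike.re_to_real]
      refine Finset.sum_congr rfl fun i _ => Finset.sum_congr rfl fun j _ => ?_
      simp [K, h.1 j i]
      ring
  have : Fact K.PosSemidef := ⟨hK⟩
  refine ⟨RKHS.OfKernel K, inferInstance, inferInstance, inferInstance,
    fun x => RKHS.kerFun (RKHS.OfKernel K) x 1, fun x y => ?_⟩
  have hin : ∀ a b : X, inner ℝ (RKHS.kerFun (RKHS.OfKernel K) a 1)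
      (RKHS.kerFun (RKHS.OfKernel K) b 1) = (κ a o + κ b o - κ a b) / 2 := fun a b => by
    rw [RKHS.kerFun_inner, RKHS.kerFun_apply, RKHS.OfKernel.kernel_ofKernel]
    simp [K]
  rw [@norm_sub_sq_real, ← real_inner_self_eq_norm_sq, ← real_inner_self_eq_norm_sq, hin, hin, hin,
    h.2.1, h.2.1]
  ring

theorem isCNDKernel_of_equivalence {r : X → X → Prop} (hr : Equivalence r)
    [∀ x y, Decidable (r x y)] : IsCNDKernel fun x y => if r x y then (0 : ℝ) else 1 := by
  classical
  refine ⟨fun x y => ?_, fun x => by simp [hr.refl x], fun n x c hc => ?_⟩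
  · have : r x y ↔ r y x := ⟨hr.symm, hr.symm⟩
    simp [this]
  let q : Fin n → Quotient (⟨r, hr⟩ : Setoid X) := fun i => Quotient.mk _ (x i)
  have hq : ∀ i j, r (x i) (x j) ↔ q i = q j := fun i j =>
    (Quotient.eq (r := (⟨r, hr⟩ : Setoid X))).symm
  have hsq : ∑ k ∈ Finset.univ.image q, (∑ i, if q i = k then c i else 0) ^ 2
      = ∑ i, ∑ j, if q i = q j then c i * c j else 0 := by
    simp only [sq, Finset.sum_mul_sum]
    rw [Finset.sum_comm]
    refine Finset.sum_congr rfl fun i _ => ?_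
    rw [Finset.sum_comm]
    refine Finset.sum_congr rfl fun j _ => ?_
    rw [Finset.sum_eq_single_of_mem (q i) (by simp)]
    · by_cases hij : q i = q j
      · simp [hij]
      · simp [hij, Ne.symm hij]
    · intro k _ hk
      simp [Ne.symm hk]
  have hnn : 0 ≤ ∑ i, ∑ j, if q i = q j then c i * c j else 0 :=
    hsq ▸ Finset.sum_nonneg fun _ _ => sq_nonneg _
  have htot : ∑ i, ∑ j, c i * c j = 0 := by rw [← Finset.sum_mul_sum, hc, zero_mul]
  have : ∑ i, ∑ j, c i * c j * (if r (x i) (x j) then (0 : ℝ) else 1)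
      = ∑ i, ∑ j, c i * c j - ∑ i, ∑ j, if q i = q j then c i * c j else 0 := by
    rw [← Finset.sum_sub_distrib]
    refine Finset.sum_congr rfl fun i _ => ?_
    rw [← Finset.sum_sub_distrib]
    refine Finset.sum_congr rfl fun j _ => ?_
    by_cases hij : q i = q j <;> simp [hq, hij]
  rw [this, htot]
  linarith

theorem IsCNDKernel.integral {T : Type*} [MeasurableSpace T] {μ : Measure T}
    {κ : T → X → X → ℝ} (h : ∀ t, IsCNDKernel (κ t))
    (hint : ∀ x y, Integrable (fun t => κ t x y) μ) :
    IsCNDKernel fun x y => ∫ t, κ t x y ∂μ := by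
  refine ⟨fun x y => by simp only [(h _).1 x y], fun x => by simp [(h _).2.1 x],
    fun n x c hc => ?_⟩
  have : ∑ i, ∑ j, c i * c j * ∫ t, κ t (x i) (x j) ∂μ
      = ∫ t, ∑ i, ∑ j, c i * c j * κ t (x i) (x j) ∂μ := by
    rw [integral_finsetSum _ fun i _ => integrable_finsetSum _ fun j _ =>
      (hint (x i) (x j)).const_mul _]
    refine Finset.sum_congr rfl fun i _ => ?_
    rw [integral_finsetSum _ fun j _ => (hint (x i) (x j)).const_mul _]
    exact Finset.sum_congr rfl fun j _ => (integral_const_mul _ _).symm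
  rw [this]
  exact integral_nonpos fun t => (h t).2.2 n x c hc

end CNDKernel

/-- A coarse embedding can be built from a conditionally negative definite kernel which is
bounded on each entourage and proper. -/
theorem IsCNDKernel.admitsCoarseEmb {Γ : Type*} [Group Γ] [Countable Γ] {κ : Γ → Γ → ℝ}
    (h : IsCNDKernel κ) (hb : ∀ d : Γ, ∃ M : ℝ, ∀ x, κ x (x * d) ≤ M)
    (hp : ∀ R : ℝ, {d : Γ | ∃ x y : Γ, x⁻¹ * y = d ∧ κ x y ≤ R}.Finite) :
    AdmitsCoarseEmb Γ := by
  obtain ⟨E, i1, i2, i3, f, hf⟩ := (h.comp (equivShrink.{0} Γ).symm).exists_norm_sub_sq_eq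
  have hf' : ∀ x y, ‖f (equivShrink.{0} Γ x) - f (equivShrink.{0} Γ y)‖ ^ 2 = κ x y := by simp [hf]
  refine ⟨E, i1, i2, i3, fun x => f (equivShrink.{0} Γ x), fun F hF => ?_, fun R => ?_⟩
  · choose M hM using hb
    obtain ⟨B, hB⟩ := (hF.image M).bddAbove
    refine ⟨√B, fun x y hxy => Real.le_sqrt_of_sq_le ?_⟩
    rw [hf']
    calc κ x y = κ x (x * (x⁻¹ * y)) := by simp
      _ ≤ M (x⁻¹ * y) := hM _ _
      _ ≤ B := hB ⟨_, hxy, rfl⟩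
  · refine (hp (R ^ 2)).subset ?_
    rintro d ⟨x, y, hxy, hR⟩
    refine ⟨x, y, hxy, ?_⟩
    rw [← hf']
    exact pow_le_pow_left₀ (norm_nonneg _) hR 2

theorem AdmitsCoarseEmb.of_injective {Γ Δ : Type*} [Group Γ] [Group Δ] (φ : Γ →* Δ)
    (hφ : Function.Injective φ) (h : AdmitsCoarseEmb Δ) : AdmitsCoarseEmb Γ := by
  obtain ⟨E, i1, i2, i3, f, hb, hp⟩ := h
  refine ⟨E, i1, i2, i3, f ∘ φ, fun F hF => ?_, fun R => ?_⟩
  · obtain ⟨M, hM⟩ := hb (φ '' F) (hF.image φ)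
    exact ⟨M, fun x y hxy => hM _ _ ⟨_, hxy, by simp⟩⟩
  · refine ((hp R).preimage hφ.injOn).subset ?_
    rintro d ⟨x, y, rfl, hR⟩
    exact ⟨φ x, φ y, by simp, hR⟩

section Width

variable {X : Type*}

open scoped Classical in
/-- The length of the range of `φ` on a finite set. -/
noncomputable def finsetWidth (φ : X → ℝ) (Y : Finset X) : ℝ :=
  if h : Y.Nonempty then Y.sup' h φ - Y.inf' h φ else 0

theorem abs_sub_le_finsetWidth (φ : X → ℝ) {Y : Finset X} {a b : X} (ha : a ∈ Y) (hb : b ∈ Y) :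
    |φ a - φ b| ≤ finsetWidth φ Y := by
  rw [finsetWidth, dif_pos ⟨a, ha⟩, abs_sub_le_iff]
  have := Finset.le_sup' φ ha
  have := Finset.le_sup' φ hb
  have := Finset.inf'_le φ ha
  have := Finset.inf'_le φ hb
  constructor <;> linarith

theorem finsetWidth_nonneg (φ : X → ℝ) (Y : Finset X) : 0 ≤ finsetWidth φ Y := by
  rcases Y.eq_empty_or_nonempty with rfl | ⟨a, ha⟩
  · simp [finsetWidth]
  · exact (abs_nonneg _).trans (abs_sub_le_finsetWidth φ ha ha)

theorem finsetWidth_le (φ : X → ℝ) (Y : Finset X) :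
    finsetWidth φ Y ≤ ∑ a ∈ Y, ∑ b ∈ Y, |φ a - φ b| := by
  rcases Y.eq_empty_or_nonempty with rfl | hY
  · simp [finsetWidth]
  obtain ⟨a, ha, ha'⟩ := Finset.exists_mem_eq_sup' hY φ
  obtain ⟨b, hb, hb'⟩ := Finset.exists_mem_eq_inf' hY φ
  rw [finsetWidth, dif_pos hY, ha', hb']
  calc φ a - φ b ≤ |φ a - φ b| := le_abs_self _
    _ ≤ ∑ b ∈ Y, |φ a - φ b| :=
      Finset.single_le_sum (f := fun b => |φ a - φ b|) (fun _ _ => abs_nonneg _) hb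
    _ ≤ _ := Finset.single_le_sum (f := fun a => ∑ b ∈ Y, |φ a - φ b|)
      (fun _ _ => Finset.sum_nonneg fun _ _ => abs_nonneg _) ha

open scoped Classical in
/-- A family of finite sets indexed by pairs such that, for every `A`, the relation
that `A` does not cut `Y p q` is an equivalence relation. -/
structure IsCutFamily {P : Type*} (Y : P → P → Finset X) : Prop where
  symm : ∀ p q, Y p q = Y q p
  subsingleton : ∀ p, (Y p p : Set X).Subsingleton
  subset_union : ∀ p q r, Y p r ⊆ Y p q ∪ Y q r
  inter_nonempty : ∀ p q r, (Y p q ∩ Y q r).Nonempty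

variable {P : Type*} {Y : P → P → Finset X}

theorem IsCutFamily.equivalence (hY : IsCutFamily Y) (A : Set X) :
    Equivalence fun p q => (Y p q : Set X) ⊆ A ∨ (Y p q : Set X) ⊆ Aᶜ where
  refl p := by
    rcases (hY.subsingleton p).eq_empty_or_singleton with h | ⟨x, h⟩
    · simp [h]
    · simp only [h, Set.singleton_subset_iff]
      exact em _
  symm {p q} h := by rwa [hY.symm q p]
  trans {p q r} h h' := by
    classical
    obtain ⟨x, hx⟩ := hY.inter_nonempty p q r
    rw [Finset.mem_inter] at hx
    have hs : ∀ z ∈ Y p r, z ∈ Y p q ∨ z ∈ Y q r := fun z hz => by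
      simpa using hY.subset_union p q r hz
    rcases h with h | h <;> rcases h' with h' | h'
    · exact Or.inl fun z hz => (hs z hz).elim (fun k => h k) (fun k => h' k)
    · exact absurd (h hx.1) (h' hx.2)
    · exact absurd (h' hx.2) (h hx.1)
    · exact Or.inr fun z hz => (hs z hz).elim (fun k => h k) (fun k => h' k)

open scoped Classical in
theorem ite_subset_or_subset_compl_eq_indicator (φ : X → ℝ) {Z : Finset X} (hZ : Z.Nonempty) :
    (fun t : ℝ => if (Z : Set X) ⊆ {x | φ x ≤ t} ∨ (Z : Set X) ⊆ {x | φ x ≤ t}ᶜ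
      then (0 : ℝ) else 1)
      = (Set.Ico (Z.inf' hZ φ) (Z.sup' hZ φ)).indicator fun _ => 1 := by
  ext t
  have h1 : (Z : Set X) ⊆ {x | φ x ≤ t} ↔ Z.sup' hZ φ ≤ t := by
    simp [Set.subset_def]
  have h2 : (Z : Set X) ⊆ {x | φ x ≤ t}ᶜ ↔ t < Z.inf' hZ φ := by
    simp [Set.subset_def]
  have h3 : (Z.sup' hZ φ ≤ t ∨ t < Z.inf' hZ φ) ↔ ¬(Z.inf' hZ φ ≤ t ∧ t < Z.sup' hZ φ) := by
    rw [not_and_or, not_le, not_lt, or_comm]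
  simp only [h1, h2, h3, Set.indicator_apply, Set.mem_Ico, ite_not]

theorem IsCutFamily.isCNDKernel_finsetWidth (hY : IsCutFamily Y) (φ : X → ℝ) :
    IsCNDKernel fun p q => finsetWidth φ (Y p q) := by
  classical
  have hne : ∀ p q, (Y p q).Nonempty := fun p q =>
    (hY.inter_nonempty p q q).mono Finset.inter_subset_left
  have hint := IsCNDKernel.integral (μ := volume)
    (fun t : ℝ => isCNDKernel_of_equivalence (hY.equivalence {x | φ x ≤ t})) (fun p q => by
      rw [ite_subset_or_subset_compl_eq_indicator φ (hne p q)]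
      exact (integrable_indicator_iff measurableSet_Ico).2 (by simp))
  convert hint using 3 with p q
  rw [ite_subset_or_subset_compl_eq_indicator φ (hne p q), integral_indicator measurableSet_Ico,
    finsetWidth, dif_pos (hne p q)]
  obtain ⟨a, ha⟩ := hne p q
  have : (Y p q).inf' (hne p q) φ ≤ (Y p q).sup' (hne p q) φ :=
    (Finset.inf'_le φ ha).trans (Finset.le_sup' φ ha)
  simp [this]

end Width

section Rademacher

variable {ι : Type*}

open scoped Classical in
/-- The sum of `h` over `T` with sign `+` on `S` and `-` off `S`. -/
noncomputable def signedSum (h : ι → ℝ) (T S : Finset ι) : ℝ :=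
  ∑ i ∈ T, (if i ∈ S then 1 else -1) * h i

theorem signedSum_sub (h h' : ι → ℝ) (T S : Finset ι) :
    signedSum h T S - signedSum h' T S = signedSum (fun i => h i - h' i) T S := by
  simp only [signedSum, ← Finset.sum_sub_distrib, mul_sub]

open scoped Classical in
theorem sum_powerset_insert_signedSum (h : ι → ℝ) {T : Finset ι} {a : ι} (ha : a ∉ T)
    (F : ℝ → ℝ) :
    ∑ S ∈ (insert a T).powerset, F (signedSum h (insert a T) S)
      = ∑ S ∈ T.powerset, (F (signedSum h T S - h a) + F (signedSum h T S + h a)) := by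
  rw [Finset.sum_powerset_insert ha, Finset.sum_add_distrib]
  congr 1
  · refine Finset.sum_congr rfl fun S hS => ?_
    have : a ∉ S := fun h => ha (Finset.mem_powerset.1 hS h)
    rw [signedSum, Finset.sum_insert ha, if_neg this, signedSum]
    congr 1
    ring
  · refine Finset.sum_congr rfl fun S _ => ?_
    have : ∑ i ∈ T, (if i ∈ insert a S then 1 else -1) * h i
        = ∑ i ∈ T, (if i ∈ S then 1 else -1) * h i := by
      refine Finset.sum_congr rfl fun i hi => ?_
      have : i ≠ a := fun e => ha (e ▸ hi)
      simp [this]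
    rw [signedSum, Finset.sum_insert ha, this, signedSum]
    congr 1
    simp [add_comm]

theorem sum_signedSum_sq (h : ι → ℝ) (T : Finset ι) :
    ∑ S ∈ T.powerset, signedSum h T S ^ 2 = 2 ^ T.card * ∑ i ∈ T, h i ^ 2 := by
  classical
  induction T using Finset.induction with
  | empty => simp [signedSum]
  | insert a T ha ih =>
    rw [sum_powerset_insert_signedSum h ha (· ^ 2)]
    have : ∀ S, (signedSum h T S - h a) ^ 2 + (signedSum h T S + h a) ^ 2
        = 2 * signedSum h T S ^ 2 + 2 * h a ^ 2 := fun S => by ring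
    simp only [this, Finset.sum_add_distrib, ← Finset.mul_sum, ih, Finset.sum_insert ha,
      Finset.sum_const, Finset.card_powerset, Finset.card_insert_of_notMem ha, nsmul_eq_mul]
    push_cast
    ring

theorem sum_signedSum_pow_four_le (h : ι → ℝ) (T : Finset ι) :
    ∑ S ∈ T.powerset, signedSum h T S ^ 4 ≤ 3 * 2 ^ T.card * (∑ i ∈ T, h i ^ 2) ^ 2 := by
  classical
  induction T using Finset.induction with
  | empty => simp [signedSum]
  | insert a T ha ih =>
    rw [sum_powerset_insert_signedSum h ha (· ^ 4)]
    have : ∀ S, (signedSum h T S - h a) ^ 4 + (signedSum h T S + h a) ^ 4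
        = 2 * signedSum h T S ^ 4 + 12 * h a ^ 2 * signedSum h T S ^ 2 + 2 * h a ^ 4 :=
      fun S => by ring
    simp only [this, Finset.sum_add_distrib, ← Finset.mul_sum, sum_signedSum_sq,
      Finset.sum_insert ha, Finset.sum_const, Finset.card_powerset,
      Finset.card_insert_of_notMem ha, nsmul_eq_mul]
    push_cast
    have h4 : 0 ≤ (2 : ℝ) ^ T.card * h a ^ 4 := by positivity
    rw [pow_succ (2 : ℝ)]
    nlinarith

/-- The average over all choices of signs of a function of the signed sums. -/
noncomputable def signAverage (T : Finset ι) (F : Finset ι → ℝ) : ℝ :=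
  (2 ^ T.card)⁻¹ * ∑ S ∈ T.powerset, F S

theorem signAverage_mono (T : Finset ι) {F F' : Finset ι → ℝ} (h : ∀ S, F S ≤ F' S) :
    signAverage T F ≤ signAverage T F' :=
  mul_le_mul_of_nonneg_left (Finset.sum_le_sum fun S _ => h S) (by positivity)

theorem signAverage_sum {α : Type*} (T : Finset ι) (s : Finset α) (F : α → Finset ι → ℝ) :
    signAverage T (fun S => ∑ a ∈ s, F a S) = ∑ a ∈ s, signAverage T (F a) := by
  simp only [signAverage]
  rw [Finset.sum_comm, Finset.mul_sum]

theorem signAverage_abs_signedSum_le (h : ι → ℝ) (T : Finset ι) :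
    signAverage T (fun S => |signedSum h T S|) ≤ √(∑ i ∈ T, h i ^ 2) := by
  refine Real.le_sqrt_of_sq_le ?_
  have := sq_sum_le_card_mul_sum_sq (s := T.powerset) (f := fun S => |signedSum h T S|)
  simp only [sq_abs, sum_signedSum_sq, Finset.card_powerset] at this
  push_cast at this
  rw [signAverage, mul_pow, inv_pow, inv_mul_le_iff₀ (by positivity)]
  linarith

/-- The Khintchine inequality, with a non-optimal constant. -/
theorem le_signAverage_abs_signedSum (h : ι → ℝ) (T : Finset ι) :
    √(∑ i ∈ T, h i ^ 2) / 8 ≤ signAverage T (fun S => |signedSum h T S|) := by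
  obtain ⟨σ, hσ⟩ : ∃ σ, σ = √(∑ i ∈ T, h i ^ 2) := ⟨_, rfl⟩
  have hσ2 : σ ^ 2 = ∑ i ∈ T, h i ^ 2 :=
    hσ ▸ Real.sq_sqrt (Finset.sum_nonneg fun _ _ => sq_nonneg _)
  rw [← hσ, signAverage, le_inv_mul_iff₀ (by positivity)]
  rcases (hσ ▸ Real.sqrt_nonneg _ : 0 ≤ σ).eq_or_lt with h0 | h0
  · rw [← h0]
    simpa using Finset.sum_nonneg fun _ _ => abs_nonneg _
  have hpt : ∀ x : ℝ, x ^ 2 / (2 * σ) - x ^ 4 / (2 * σ) ^ 3 ≤ |x| := fun x => by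
    have key : ∀ y : ℝ, 0 ≤ y → y ^ 2 - y ^ 4 ≤ y := fun y hy => by
      nlinarith [mul_nonneg hy (sq_nonneg (y - 1)), mul_nonneg hy (mul_nonneg hy hy),
        mul_nonneg hy (sq_nonneg (y + 1)), sq_nonneg (y ^ 2 - 1 / 2), sq_nonneg (y - 1 / 2)]
    have := mul_le_mul_of_nonneg_left (key (|x| / (2 * σ)) (by positivity))
      (by positivity : 0 ≤ 2 * σ)
    have e1 : 2 * σ * ((|x| / (2 * σ)) ^ 2 - (|x| / (2 * σ)) ^ 4)
        = x ^ 2 / (2 * σ) - x ^ 4 / (2 * σ) ^ 3 := by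
      rw [div_pow, div_pow, sq_abs, Even.pow_abs (by decide)]
      field_simp
    have e2 : 2 * σ * (|x| / (2 * σ)) = |x| := mul_div_cancel₀ _ (by positivity)
    rwa [e1, e2] at this
  have hsum := Finset.sum_le_sum fun S (_ : S ∈ T.powerset) => hpt (signedSum h T S)
  rw [Finset.sum_sub_distrib, ← Finset.sum_div, ← Finset.sum_div, sum_signedSum_sq, ← hσ2] at hsum
  have h4 : (∑ S ∈ T.powerset, signedSum h T S ^ 4) / (2 * σ) ^ 3
      ≤ 3 * 2 ^ T.card * (σ ^ 2) ^ 2 / (2 * σ) ^ 3 := by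
    rw [hσ2]
    exact div_le_div_of_nonneg_right (sum_signedSum_pow_four_le h T) (by positivity)
  have e3 : 2 ^ T.card * σ ^ 2 / (2 * σ) - 3 * 2 ^ T.card * (σ ^ 2) ^ 2 / (2 * σ) ^ 3
      = 2 ^ T.card * (σ / 8) := by
    field_simp
    ring
  linarith

end Rademacher

/-- Mean width: a map to a Hilbert space gives a functional on finite sets which is comparable to
the diameter of the image and is conditionally negative definite along cut families. -/
theorem exists_meanWidth {X E : Type*} [NormedAddCommGroup E] [InnerProductSpace ℝ E]
    [CompleteSpace E] (f : X → E) : ∃ w : Finset X → ℝ,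
      (∀ (Y : Finset X), ∀ a ∈ Y, ∀ b ∈ Y, ‖f a - f b‖ / 8 ≤ w Y) ∧
      (∀ Y : Finset X, w Y ≤ ∑ a ∈ Y, ∑ b ∈ Y, ‖f a - f b‖) ∧
      ∀ {P : Type _} (Y : P → P → Finset X), IsCutFamily Y → IsCNDKernel fun p q => w (Y p q) := by
  obtain ⟨ι, e, -⟩ := exists_hilbertBasis ℝ E
  let φ : Finset ι → Finset ι → X → ℝ := fun T S x => signedSum (fun i => inner ℝ (e i) (f x)) T S
  let w : Finset ι → Finset X → ℝ := fun T Y => signAverage T fun S => finsetWidth (φ T S) Y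
  have hφ : ∀ T S a b, φ T S a - φ T S b = signedSum (fun i => inner ℝ (e i) (f a - f b)) T S :=
    fun T S a b => by simp only [φ, signedSum_sub, inner_sub_right]
  have hparseval : ∀ v : E, HasSum (fun i => inner ℝ (e i) v ^ 2) (‖v‖ ^ 2) := fun v => by
    have := e.hasSum_inner_mul_inner v v
    rw [real_inner_self_eq_norm_sq] at this
    simpa only [real_inner_comm v, ← sq] using this
  have hlower : ∀ (T : Finset ι) (Y : Finset X), ∀ a ∈ Y, ∀ b ∈ Y,
      √(∑ i ∈ T, inner ℝ (e i) (f a - f b) ^ 2) / 8 ≤ w T Y := fun T Y a ha b hb =>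
    (le_signAverage_abs_signedSum _ T).trans
      (signAverage_mono T fun S => by rw [← hφ]; exact abs_sub_le_finsetWidth _ ha hb)
  have hupper : ∀ (T : Finset ι) (Y : Finset X), w T Y ≤ ∑ a ∈ Y, ∑ b ∈ Y, ‖f a - f b‖ := by
    intro T Y
    refine (signAverage_mono T fun S => finsetWidth_le (φ T S) Y).trans ?_
    simp only [signAverage_sum]
    refine Finset.sum_le_sum fun a _ => Finset.sum_le_sum fun b _ => ?_
    simp only [hφ]
    refine (signAverage_abs_signedSum_le _ T).trans (Real.sqrt_le_iff.2 ⟨norm_nonneg _, ?_⟩)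
    exact sum_le_hasSum T (fun _ _ => sq_nonneg _) (hparseval _)
  have hnn : ∀ (T : Finset ι) (Y : Finset X), 0 ≤ w T Y := fun T Y =>
    mul_nonneg (by positivity) (Finset.sum_nonneg fun S _ => finsetWidth_nonneg _ _)
  let U : Ultrafilter (Finset ι) := Ultrafilter.of Filter.atTop
  have hU : (U : Filter (Finset ι)) ≤ Filter.atTop := Ultrafilter.of_le _
  have hlim : ∀ Y : Finset X, ∃ l, Filter.Tendsto (fun T => w T Y) U (nhds l) := fun Y => by
    obtain ⟨l, -, hl⟩ := (isCompact_Icc (a := (0 : ℝ))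
      (b := ∑ a ∈ Y, ∑ b ∈ Y, ‖f a - f b‖)).ultrafilter_le_nhds (U.map fun T => w T Y)
      (by
        rw [Filter.le_principal_iff]
        exact Filter.Eventually.of_forall (f := (U : Filter (Finset ι))) fun T =>
          ⟨hnn T Y, hupper T Y⟩)
    exact ⟨l, hl⟩
  choose W hW using hlim
  refine ⟨W, fun Y a ha b hb => ?_, fun Y => le_of_tendsto' (hW Y) fun T => hupper T Y,
    fun {P} Y hY => ?_⟩
  · refine le_of_tendsto_of_tendsto' ?_ (hW Y) fun T => hlower T Y a ha b hb
    have := (((hparseval (f a - f b)).mono_left hU).sqrt).div_const 8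
    rwa [Real.sqrt_sq (norm_nonneg _)] at this
  · exact IsCNDKernel.of_tendsto (fun T => (IsCNDKernel.finsetSum _ fun S _ =>
      hY.isCNDKernel_finsetWidth (φ T S)).const_mul (by positivity)) fun p q => hW (Y p q)

open scoped Classical in
/-- The converse direction of the main theorem for a gauge that vanishes at the identity. -/
theorem AdmitsCoarseEmb.semidirectProduct_of_gauge {G W : Type*} [Group G] [Group W]
    [Countable G] [Countable W] [MulDistribMulAction G W]
    (ψ : W → Finset G) (hone : ψ 1 = ∅)
    (hinv : ∀ w : W, ψ w⁻¹ = ψ w)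
    (hsub : ∀ w w' : W, ψ (w * w') ⊆ ψ w ∪ ψ w')
    (hequiv : ∀ (g : G) (w : W), (ψ (g • w) : Set G) = (fun x => g * x) '' (ψ w : Set G))
    (u : W → W → ℝ) (hu : IsCNDKernel u)
    (huG : ∀ (g : G) (v w : W), u (g • v) (g • w) = u v w)
    (huW : ∀ w₁ w₂ : W, ∃ M : ℝ, ∀ v : W, u (v * w₁) (v * w₂) ≤ M)
    (hctrl : ∀ (F : Finset G) (R : ℝ), 0 < R →
      {d : W | ∃ v w : W, v⁻¹ * w = d ∧ (ψ (v⁻¹ * w) : Set G) ⊆ (F : Set G) ∧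
        u v w ≤ R}.Finite)
    (hG : AdmitsCoarseEmb G) :
    AdmitsCoarseEmb (W ⋊[MulDistribMulAction.toMulAut G W] G) := by
  obtain ⟨E, _, _, _, f, hb, hp⟩ := hG
  obtain ⟨w, hlow, hup, hcnd⟩ := exists_meanWidth f
  have : Countable (W ⋊[MulDistribMulAction.toMulAut G W] G) :=
    SemidirectProduct.equivProd.countable_iff.2 inferInstance
  let Y : (W ⋊[MulDistribMulAction.toMulAut G W] G) →
      (W ⋊[MulDistribMulAction.toMulAut G W] G) → Finset G :=
    fun p q => insert p.right (insert q.right (ψ (p.left⁻¹ * q.left)))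
  have hY : IsCutFamily Y := by
    refine ⟨fun p q => ?_, fun p => ?_, fun p q r => ?_, fun p q r => ⟨q.right, ?_⟩⟩
    · have : ψ (p.left⁻¹ * q.left) = ψ (q.left⁻¹ * p.left) := by
        rw [← hinv]
        simp
      simp only [Y, this]
      exact Finset.insert_comm _ _ _
    · simp [Y, hone]
    · have := hsub (p.left⁻¹ * q.left) (q.left⁻¹ * r.left)
      rw [mul_assoc, mul_inv_cancel_left] at this
      intro z hz
      simp only [Y, Finset.mem_insert, Finset.mem_union] at hz ⊢
      rcases hz with h | h | h
      · tauto
      · tauto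
      · have := Finset.mem_union.1 (this h)
        tauto
    · simp [Y]
  let Y₀ : (W ⋊[MulDistribMulAction.toMulAut G W] G) → Finset G :=
    fun d => insert 1 (insert d.right (ψ d.left))
  have hYY₀ : ∀ x d : W ⋊[MulDistribMulAction.toMulAut G W] G,
      Y x (x * d) = (Y₀ d).image (x.right * ·) := fun x d => by
    have h1 : ψ (x.right • d.left) = (ψ d.left).image (x.right * ·) := by
      rw [← Finset.coe_inj, hequiv, Finset.coe_image]
    simp only [Y, Y₀, SemidirectProduct.mul_left, SemidirectProduct.mul_right,
      MulDistribMulAction.toMulAut_apply, MulDistribMulAction.toMulEquiv_apply,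
      inv_mul_cancel_left, h1, Finset.image_insert, mul_one]
  have hleft : ∀ x d : W ⋊[MulDistribMulAction.toMulAut G W] G,
      x.right⁻¹ • (x * d).left = (x.right⁻¹ • x.left) * d.left := fun x d => by
    simp [smul_mul']
  refine ((hcnd Y hY).add (hu.comp fun p : W ⋊[MulDistribMulAction.toMulAut G W] G =>
    p.left)).admitsCoarseEmb (fun d => ?_)
    (fun R => ?_)
  · have hb' : ∀ a b : G, ∃ M : ℝ, ∀ g : G, ‖f (g * a) - f (g * b)‖ ≤ M := fun a b => by
      obtain ⟨M, hM⟩ := hb {a⁻¹ * b} (Set.finite_singleton _)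
      exact ⟨M, fun g => hM _ _ (by simp [mul_assoc])⟩
    choose M hM using hb'
    obtain ⟨N, hN⟩ := huW 1 d.left
    refine ⟨∑ a ∈ Y₀ d, ∑ b ∈ Y₀ d, M a b + N, fun x => add_le_add ?_ ?_⟩
    · refine (hup _).trans ?_
      have hinj : Set.InjOn (x.right * ·) (Y₀ d : Set G) := (mul_right_injective x.right).injOn
      rw [hYY₀, Finset.sum_image hinj]
      simp only [Finset.sum_image hinj]
      exact Finset.sum_le_sum fun a _ => Finset.sum_le_sum fun b _ => hM a b _
    · rw [← huG x.right⁻¹, hleft]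
      simpa using hN (x.right⁻¹ • x.left)
  · have hF := hp (8 * R)
    have hD := hctrl hF.toFinset (max R 1) (by simp)
    refine ((hD.prod hF).image fun z =>
      (⟨z.1, z.2⟩ : W ⋊[MulDistribMulAction.toMulAut G W] G)).subset ?_
    rintro d ⟨x, y, hxy, hR⟩
    obtain rfl : y = x * d := by rw [← hxy, mul_inv_cancel_left]
    have hw : w (Y x (x * d)) ≤ R := by linarith [hu.nonneg x.left (x * d).left]
    have hu' : u x.left (x * d).left ≤ R := by linarith [(hcnd Y hY).nonneg x (x * d)]
    have hmem : ∀ a ∈ Y₀ d, a ∈ {g : G | ∃ x y : G, x⁻¹ * y = g ∧ ‖f x - f y‖ ≤ 8 * R} := by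
      intro a ha
      refine ⟨x.right, x.right * a, by simp, ?_⟩
      have := hlow (Y x (x * d)) x.right (by simp [Y]) (x.right * a)
        (by rw [hYY₀]; exact Finset.mem_image_of_mem _ ha)
      linarith
    refine ⟨(d.left, d.right), ⟨⟨x.right⁻¹ • x.left, x.right⁻¹ • (x * d).left, ?_, ?_, ?_⟩, ?_⟩,
      rfl⟩
    · rw [hleft, inv_mul_cancel_left]
    · rw [hleft, inv_mul_cancel_left]
      intro a ha
      simpa using hmem a (by simp [Y₀, Finset.mem_coe.1 ha])
    · rw [huG]
      exact hu'.trans (le_max_left _ _)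
    · exact hmem _ (by simp [Y₀])

open scoped Classical in
/-- **Theorem.** Let `G` act by automorphisms on `W`, with a `W`-invariant `G`-equivariant
gauge `ψ` on `W` with values in finite subsets of `G`, and let `u` be a `G`-invariant,
`W`-uniform conditionally negative definite kernel on `W` such that, for every finite
`F ⊆ G` and `R > 0`, the set `{v⁻¹w | ψ(v⁻¹w) ⊆ F, u(v,w) ≤ R}` is finite. Then `W ⋊ G`
coarsely embeds into a Hilbert space iff `G` does. -/
theorem semidirect_coarse_embedding_iff {G W : Type*} [Group G] [Group W]
    [Countable G] [Countable W] [MulDistribMulAction G W]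
    (ψ : W → Finset G)
    (hinv : ∀ w : W, ψ w⁻¹ = ψ w)
    (hsub : ∀ w w' : W, ψ (w * w') ⊆ ψ w ∪ ψ w')
    (hequiv : ∀ (g : G) (w : W), (ψ (g • w) : Set G) = (fun x => g * x) '' (ψ w : Set G))
    (u : W → W → ℝ) (hu : IsCNDKernel u)
    (huG : ∀ (g : G) (v w : W), u (g • v) (g • w) = u v w)
    (huW : ∀ w₁ w₂ : W, ∃ M : ℝ, ∀ v : W, u (v * w₁) (v * w₂) ≤ M)
    (hctrl : ∀ (F : Finset G) (R : ℝ), 0 < R →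
      {d : W | ∃ v w : W, v⁻¹ * w = d ∧ (ψ (v⁻¹ * w) : Set G) ⊆ (F : Set G) ∧
        u v w ≤ R}.Finite) :
    AdmitsCoarseEmb (W ⋊[MulDistribMulAction.toMulAut G W] G) ↔ AdmitsCoarseEmb G := by
  refine ⟨fun h => h.of_injective SemidirectProduct.inr SemidirectProduct.inr_injective, ?_⟩
  let ψ' : W → Finset G := fun w => if w = 1 then ∅ else ψ w
  have hψ' : ∀ w, w ≠ 1 → ψ' w = ψ w := fun w hw => if_neg hw
  have hψ'1 : ψ' 1 = ∅ := if_pos rfl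
  have hle : ∀ w, ψ' w ⊆ ψ w := fun w => by
    by_cases hw : w = 1
    · simp [hw, hψ'1]
    · rw [hψ' w hw]
  refine AdmitsCoarseEmb.semidirectProduct_of_gauge ψ' hψ'1 (fun w => ?_) (fun w w' => ?_)
    (fun g w => ?_) u hu huG huW (fun F R hR => ?_)
  · simp [ψ', hinv]
  · by_cases hw : w = 1
    · simp [hw]
    by_cases hw' : w' = 1
    · simp [hw']
    rw [hψ' w hw, hψ' w' hw']
    exact (hle _).trans (hsub w w')
  · by_cases hw : w = 1
    · simp [hw, hψ'1]
    · rw [hψ' w hw, hψ' _ (by simpa [smul_eq_iff_eq_inv_smul] using hw), hequiv]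
  · refine ((hctrl F R hR).insert 1).subset ?_
    rintro d ⟨v, w, rfl, hF, hR'⟩
    by_cases hvw : v⁻¹ * w = 1
    · exact Or.inl hvw
    · rw [hψ' _ hvw] at hF
      exact Or.inr ⟨v, w, rfl, hF, hR'⟩
end

section
/- Let H, G be countable groups and X a nonempty countable G-set. Then the permutational wreath product H ≀_X G has relative Property T with respect to some infinite subgroup if and only if H or G has relative Property T with respect to some infinite subgroup. -/
open MeasureTheory Function Set
open scoped ENNReal
/-- Relative Property (T) for a pair `(Γ, S)`: every conditionally negative definite
function on `Γ` is bounded on `S`. -/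
def RelPropT (Γ : Type*) [Group Γ] (S : Set Γ) : Prop :=
  ∀ ψ : Γ → ℝ, IsCNDFunction ψ → ∃ M : ℝ, ∀ s ∈ S, ψ s ≤ M
/-- The group of finitely supported functions `X → H` under pointwise multiplication. -/
def FinSuppSubgroup (H : Type*) [Group H] (X : Type*) : Subgroup (X → H) where
  carrier := {w | (Function.mulSupport w).Finite}
  one_mem' := by simpa [Function.mulSupport_one] using Set.finite_empty
  mul_mem' := by
    intro a b ha hb
    exact (ha.union hb).subset (Function.mulSupport_mul a b)
  inv_mem' := by
    intro a ha
    simpa [Function.mulSupport_inv] using ha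

/-- The shift action of `G` on finitely supported functions `X → H`, for a `G`-set `X`:
`(g·w)(x) = w(g⁻¹ • x)`. -/
def wreathShift (H : Type*) [Group H] (X : Type*) (G : Type*) [Group G] [MulAction G X] :
    G →* MulAut (FinSuppSubgroup H X) where
  toFun g :=
    { toFun := fun w => ⟨fun x => (w : X → H) (g⁻¹ • x), by
        refine (w.2.image (fun x => g • x)).subset ?_
        intro x hx
        exact ⟨g⁻¹ • x, hx, by simp⟩⟩
      invFun := fun w => ⟨fun x => (w : X → H) (g • x), by
        refine (w.2.image (fun x => g⁻¹ • x)).subset ?_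
        intro x hx
        exact ⟨g • x, hx, by simp⟩⟩
      left_inv := by intro w; apply Subtype.ext; funext x; simp
      right_inv := by intro w; apply Subtype.ext; funext x; simp
      map_mul' := by intro a b; rfl }
  map_one' := by
    apply MulEquiv.ext; intro w; apply Subtype.ext; funext x; simp
  map_mul' := by
    intro a b
    apply MulEquiv.ext; intro w; apply Subtype.ext; funext x
    simp [mul_smul]

/-- The permutational wreath product `H ≀_X G = H^{(X)} ⋊ G`. -/
abbrev PermWreath (H : Type*) [Group H] (X : Type*) (G : Type*) [Group G] [MulAction G X] :=
  FinSuppSubgroup H X ⋊[wreathShift H X G] G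

/-- The standard wreath product `H ≀ G = H^{(G)} ⋊ G`. -/
abbrev StandardWreath (H : Type*) [Group H] (G : Type*) [Group G] := PermWreath H G G

namespace IsCNDFunction

variable {G : Type*} [Group G] {ψ : G → ℝ}

theorem map_one (hψ : IsCNDFunction ψ) : ψ 1 = 0 := by
  simpa using hψ.2.1 1

theorem map_inv (hψ : IsCNDFunction ψ) (g : G) : ψ g⁻¹ = ψ g := by
  simpa using hψ.1 g 1

theorem nonneg (hψ : IsCNDFunction ψ) (g : G) : 0 ≤ ψ g := by
  have h := hψ.2.2 2 ![1, g] ![1, -1] (by simp)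
  simp [Fin.sum_univ_two, hψ.map_one, hψ.map_inv] at h
  linarith

theorem comp {G' : Type*} [Group G'] (hψ : IsCNDFunction ψ) (f : G' →* G) :
    IsCNDFunction fun g => ψ (f g) := by
  refine ⟨fun x y => ?_, fun x => ?_, fun n x c hc => ?_⟩
  · simpa using hψ.1 (f x) (f y)
  · simpa using hψ.2.1 (f x)
  · simpa using hψ.2.2 n (fun i => f (x i)) c hc

end IsCNDFunction

theorem RelPropT.image {Γ Γ' : Type*} [Group Γ] [Group Γ'] {S : Set Γ} (hS : RelPropT Γ S)
    (f : Γ →* Γ') : RelPropT Γ' (f '' S) := by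
  intro ψ hψ
  obtain ⟨M, hM⟩ := hS _ (hψ.comp f)
  exact ⟨M, by rintro _ ⟨s, hs, rfl⟩; exact hM s hs⟩

open Classical in
/-- The indicator function of the complement of the identity is conditionally negative
definite. -/
theorem isCNDFunction_ite_eq_one (G : Type*) [Group G] :
    IsCNDFunction fun g : G => if g = 1 then (0 : ℝ) else 1 := by
  refine ⟨fun x y => ?_, fun x => by simp, fun n x c hc => ?_⟩
  · simp only [inv_mul_eq_one, eq_comm]
  · have hrw : ∀ i j, c i * c j * (if (x i)⁻¹ * x j = 1 then (0 : ℝ) else 1) =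
        c i * c j - ∑ y ∈ Finset.univ.image x,
          (if x i = y then c i else 0) * (if x j = y then c j else 0) := by
      intro i j
      rw [Finset.sum_eq_single (x i) (fun y _ hy => by simp [hy.symm]) (by simp)]
      by_cases h : x i = x j
      · simp [h]
      · simp [inv_mul_eq_one, h, Ne.symm h]
    have hsq : ∑ i, ∑ j, ∑ y ∈ Finset.univ.image x,
          (if x i = y then c i else 0) * (if x j = y then c j else 0) =
        ∑ y ∈ Finset.univ.image x, (∑ i, if x i = y then c i else 0) ^ 2 := by
      simp_rw [sq, Finset.sum_mul_sum]
      rw [Finset.sum_comm]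
      simp_rw [Finset.sum_comm (s := Finset.univ) (t := Finset.univ.image x)]
      exact Finset.sum_congr rfl fun y _ => Finset.sum_comm
    simp_rw [hrw, Finset.sum_sub_distrib]
    rw [hsq, ← Finset.sum_mul_sum, hc]
    have := Finset.sum_nonneg fun y (_ : y ∈ Finset.univ.image x) =>
      sq_nonneg (∑ i, if x i = y then c i else 0)
    linarith

section PermWreath

variable {H G X : Type*} [Group H] [Group G] [MulAction G X]

theorem support_comp_subset_mulSupport {ψ : H → ℝ} (h1 : ψ 1 = 0) (w : X → H) :
    (support fun x => ψ (w x)) ⊆ mulSupport w := by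
  intro x hx hw
  exact hx (by simp [hw, h1])

theorem PermWreath.inv_mul_left_apply (a b : PermWreath H X G) (x : X) :
    ((a⁻¹ * b).left : X → H) x =
      ((a.left : X → H) (a.right • x))⁻¹ * (b.left : X → H) (a.right • x) := by
  simp [wreathShift]

/-- A conditionally negative definite function on `H`, summed over the coordinates, is
conditionally negative definite on `H ≀_X G`. -/
theorem IsCNDFunction.finsum_left {ψ : H → ℝ} (hψ : IsCNDFunction ψ) :
    IsCNDFunction fun a : PermWreath H X G => ∑ᶠ x, ψ ((a.left : X → H) x) := by
  have key : ∀ a b : PermWreath H X G, ∑ᶠ x, ψ (((a⁻¹ * b).left : X → H) x) =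
      ∑ᶠ x, ψ (((a.left : X → H) x)⁻¹ * (b.left : X → H) x) := by
    intro a b
    simp_rw [PermWreath.inv_mul_left_apply]
    exact finsum_comp_equiv (MulAction.toPerm a.right)
      (f := fun x => ψ (((a.left : X → H) x)⁻¹ * (b.left : X → H) x))
  refine ⟨fun a b => ?_, fun a => ?_, fun n a c hc => ?_⟩
  · simp only [key]
    exact finsum_congr fun x => hψ.1 _ _
  · simp [hψ.map_one]
  · simp only [key]
    have hfin : (⋃ i, mulSupport ((a i).left : X → H)).Finite :=
      Set.finite_iUnion fun i => (a i).left.2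
    have hsum : ∀ i j, ∑ᶠ x, ψ ((((a i).left : X → H) x)⁻¹ * ((a j).left : X → H) x) =
        ∑ x ∈ hfin.toFinset, ψ ((((a i).left : X → H) x)⁻¹ * ((a j).left : X → H) x) := by
      intro i j
      apply finsum_eq_sum_of_support_subset
      intro x hx
      by_contra hx'
      simp only [Finite.coe_toFinset, mem_iUnion, mem_mulSupport, not_exists, not_not] at hx'
      exact hx (by simp [hx', hψ.map_one])
    simp_rw [hsum, Finset.mul_sum]
    rw [Finset.sum_congr rfl fun i _ => Finset.sum_comm, Finset.sum_comm]
    exact Finset.sum_nonpos fun x _ => hψ.2.2 n (fun i => ((a i).left : X → H) x) c hc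

/-- Evaluation at a point, on finitely supported functions. -/
def FinSuppSubgroup.coord (H : Type*) [Group H] {X : Type*} (x : X) : FinSuppSubgroup H X →* H :=
  (Pi.evalMonoidHom (fun _ : X => H) x).comp (FinSuppSubgroup H X).subtype

open Classical in
/-- The coordinate embedding `H → H^{(X)}`. -/
noncomputable def FinSuppSubgroup.mulSingle (H : Type*) [Group H] {X : Type*} (x : X) :
    H →* FinSuppSubgroup H X :=
  (MonoidHom.mulSingle (fun _ : X => H) x).codRestrict _ fun _ =>
    (Set.finite_singleton x).subset Pi.mulSupport_mulSingle_subset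

open Classical in
theorem FinSuppSubgroup.coord_mulSingle (x : X) (a : H) :
    FinSuppSubgroup.coord H x (FinSuppSubgroup.mulSingle H x a) = a :=
  Pi.mulSingle_eq_same (M := fun _ : X => H) x a

theorem FinSuppSubgroup.mulSingle_injective (x : X) :
    Injective (FinSuppSubgroup.mulSingle H x) := by
  intro a b hab
  simpa only [FinSuppSubgroup.coord_mulSingle] using congrArg (FinSuppSubgroup.coord H x) hab

/-- A subgroup of `H^{(X)}` with uniformly bounded supports and finite coordinate projections is
finite. -/
theorem FinSuppSubgroup.finite_of_ncard_mulSupport_le {L : Subgroup (FinSuppSubgroup H X)}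
    {M : ℕ} (hM : ∀ w ∈ L, (mulSupport (w : X → H)).ncard ≤ M)
    (hL : ∀ x : X, ((fun w : FinSuppSubgroup H X => (w : X → H) x) '' L).Finite) :
    (L : Set (FinSuppSubgroup H X)).Finite := by
  obtain ⟨w, hwL, hw⟩ : ∃ w ∈ L, ∀ v ∈ L,
      (mulSupport (v : X → H)).ncard ≤ (mulSupport (w : X → H)).ncard := by
    have hbdd : ((fun w : FinSuppSubgroup H X => (mulSupport (w : X → H)).ncard) '' L).Finite :=
      (Set.finite_Iic M).subset (by rintro _ ⟨v, hv, rfl⟩; exact hM v hv)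
    obtain ⟨w, hw, hmax⟩ := Set.exists_max_image _ id hbdd ⟨_, 1, L.one_mem, rfl⟩
    obtain ⟨w, hwL, rfl⟩ := hw
    exact ⟨w, hwL, fun v hv => hmax _ ⟨v, hv, rfl⟩⟩
  set S := mulSupport (w : X → H) with hS
  have hSfin : S.Finite := w.2
  have htriv : ∀ k ∈ L, (∀ x ∈ S, (k : X → H) x = 1) → k = 1 := by
    intro k hk hkS
    by_contra hne
    obtain ⟨y, hy⟩ : ∃ y, (k : X → H) y ≠ 1 := by
      by_contra! h
      exact hne (Subtype.ext (funext h))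
    have hyS : y ∉ S := fun h => hy (hkS y h)
    have hsub : insert y S ⊆ mulSupport ((w * k : FinSuppSubgroup H X) : X → H) := by
      rintro z (rfl | hz)
      · have : (w : X → H) z = 1 := by simpa [hS] using hyS
        simpa [this] using hy
      · simpa [hkS z hz, hS] using hz
    have h1 := Set.ncard_le_ncard hsub (w * k).2
    rw [Set.ncard_insert_of_notMem hyS hSfin] at h1
    have h2 := hw (w * k) (L.mul_mem hwL hk)
    omega
  have := hSfin.to_subtype
  refine Set.Finite.of_finite_image (f := fun (k : FinSuppSubgroup H X) (x : S) => (k : X → H) x)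
    ((Set.Finite.pi fun x : S => hL x).subset ?_) ?_
  · rintro _ ⟨k, hk, rfl⟩ x -
    exact ⟨k, hk, rfl⟩
  · intro a ha b hb hab
    refine (inv_mul_eq_one.1 (htriv _ (L.mul_mem (L.inv_mem ha) hb) fun x hx => ?_))
    have : (a : X → H) x = (b : X → H) x := congrFun hab ⟨x, hx⟩
    simp [this]

theorem RelPropT.exists_ncard_mulSupport_le {S : Set (PermWreath H X G)}
    (hS : RelPropT (PermWreath H X G) S) :
    ∃ M : ℕ, ∀ a ∈ S, (mulSupport (a.left : X → H)).ncard ≤ M := by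
  classical
  obtain ⟨M, hM⟩ := hS _ (isCNDFunction_ite_eq_one H).finsum_left
  refine ⟨⌊M⌋₊, fun a ha => Nat.le_floor ((le_of_eq ?_).trans (hM a ha))⟩
  have hfin : (mulSupport (a.left : X → H)).Finite := a.left.2
  rw [finsum_eq_sum_of_support_subset (s := hfin.toFinset) _
      (by simp),
    Finset.sum_congr rfl fun x hx => if_neg (by simpa using hx), Set.ncard_eq_toFinset_card _ hfin]
  simp

theorem RelPropT.image_left_apply {S : Set (PermWreath H X G)}
    (hS : RelPropT (PermWreath H X G) S) (x : X) :
    RelPropT H ((fun a : PermWreath H X G => (a.left : X → H) x) '' S) := by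
  intro ψ hψ
  obtain ⟨M, hM⟩ := hS _ hψ.finsum_left
  refine ⟨M, ?_⟩
  rintro _ ⟨a, ha, rfl⟩
  refine le_trans ?_ (hM a ha)
  exact single_le_finsum x
    (a.left.2.subset (support_comp_subset_mulSupport hψ.map_one (a.left : X → H)))
    fun y => hψ.nonneg _

/-- A subgroup of a semidirect product is finite if its image in the quotient and its intersection
with the kernel are finite. -/
theorem SemidirectProduct.finite_of_finite_map_of_finite_comap {N G : Type*} [Group N] [Group G]
    {φ : G →* MulAut N} {K : Subgroup (N ⋊[φ] G)}
    (hmap : (K.map SemidirectProduct.rightHom : Set G).Finite)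
    (hcomap : (K.comap SemidirectProduct.inl : Set N).Finite) : (K : Set (N ⋊[φ] G)).Finite := by
  refine Set.Finite.of_finite_fibers SemidirectProduct.rightHom hmap fun g _ => ?_
  rcases Set.eq_empty_or_nonempty ((K : Set (N ⋊[φ] G)) ∩ SemidirectProduct.rightHom ⁻¹' {g})
    with h | ⟨a, haK, hag⟩
  · rw [h]
    exact Set.finite_empty
  · refine (hcomap.image fun n => a * SemidirectProduct.inl n).subset ?_
    rintro b ⟨hbK, hbg⟩
    have hker : a⁻¹ * b ∈ (SemidirectProduct.rightHom : N ⋊[φ] G →* G).ker := by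
      rw [MonoidHom.mem_ker, _root_.map_mul, _root_.map_inv, hag, hbg, inv_mul_cancel]
    rw [← SemidirectProduct.range_inl_eq_ker_rightHom] at hker
    obtain ⟨n, hn⟩ := hker
    refine ⟨n, ?_, by simp [hn]⟩
    change SemidirectProduct.inl n ∈ K
    rw [hn]
    exact K.mul_mem (K.inv_mem haK) hbK

end PermWreath

/-- **Theorem.** The permutational wreath product `H ≀_X G` has relative Property (T) with
respect to some infinite subgroup iff `H` or `G` does. -/
theorem perm_wreath_infinite_relative_T {H G X : Type*} [Group H] [Group G]
    [Countable H] [Countable G] [Countable X] [Nonempty X] [MulAction G X] :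
    (∃ K : Subgroup (PermWreath H X G),
        (K : Set (PermWreath H X G)).Infinite ∧ RelPropT (PermWreath H X G) (K : Set _)) ↔
    ((∃ K : Subgroup H, (K : Set H).Infinite ∧ RelPropT H (K : Set H)) ∨
     (∃ K : Subgroup G, (K : Set G).Infinite ∧ RelPropT G (K : Set G))) := by
  constructor
  · rintro ⟨K, hKinf, hK⟩
    by_contra! hcon
    obtain ⟨hH, hG⟩ := hcon
    refine hKinf (SemidirectProduct.finite_of_finite_map_of_finite_comap ?_ ?_)
    · by_contra hinf
      exact hG _ hinf (hK.image SemidirectProduct.rightHom)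
    · have hL : RelPropT (PermWreath H X G)
          (SemidirectProduct.inl '' (K.comap SemidirectProduct.inl : Set (FinSuppSubgroup H X))) :=
        fun ψ hψ => (hK ψ hψ).imp fun M hM => by rintro _ ⟨w, hw, rfl⟩; exact hM _ hw
      obtain ⟨M, hM⟩ := hL.exists_ncard_mulSupport_le
      refine FinSuppSubgroup.finite_of_ncard_mulSupport_le
        (fun w hw => hM _ (Set.mem_image_of_mem _ hw)) fun x => ?_
      by_contra hinf
      refine hH ((K.comap SemidirectProduct.inl).map (FinSuppSubgroup.coord H x)) hinf ?_
      have := hL.image_left_apply x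
      rwa [Set.image_image] at this
  · rintro (⟨K, hKinf, hK⟩ | ⟨K, hKinf, hK⟩)
    · obtain ⟨x⟩ := ‹Nonempty X›
      let f : H →* PermWreath H X G :=
        SemidirectProduct.inl.comp (FinSuppSubgroup.mulSingle H x)
      have hf : Injective f :=
        SemidirectProduct.inl_injective.comp (FinSuppSubgroup.mulSingle_injective x)
      exact ⟨K.map f, hKinf.image hf.injOn, hK.image f⟩
    · exact ⟨K.map SemidirectProduct.inr, hKinf.image SemidirectProduct.inr_injective.injOn,
        hK.image _⟩
end
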